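/- Let K ⊂ H⁺(y₀)×X be an invariant set, let (N₁,N₂) be an index pair for (y₀,K), and define f : N₁ → [0,∞] by f(t,x) := sup{t₀ ≥ 0 : (t,x)χ_{y₀}s ∈ cl_{[0,∞)×X}(N₁∖N₂) for all s ∈ [0,t₀]} (with sup ∅ := 0). Then f is bounded on N₂, i.e. there exists C < ∞ with f(t,x) ≤ C for all (t,x) ∈ N₂. -/

import Mathlib

open Filter Topology Set
open scoped NNReal ENNReal

noncomputable section

/-- A partial semiflow on a topological space `Z`. The value `none` plays the role of the
symbol `◊` ("undefined").  Time is modelled by `ℝ≥0`. -/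
structure PartialSemiflow (Z : Type*) [TopologicalSpace Z] where
  /-- The (partially defined) flow map. -/
  flow : ℝ≥0 → Z → Option Z
  /-- The domain of definition is open in `[0,∞) × Z`. -/
  isOpen_dom : IsOpen {p : ℝ≥0 × Z | (flow p.1 p.2).isSome = true}
  /-- The flow is continuous on its domain of definition. -/
  continuous_flow : ∀ V : Set Z, IsOpen V →
    IsOpen {p : ℝ≥0 × Z | ∃ z ∈ V, flow p.1 p.2 = some z}
  /-- `z π 0 = z`. -/
  flow_zero : ∀ z, flow 0 z = some z
  /-- The semigroup property; `◊ π t = ◊` is built into `Option.bind`. -/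
  flow_add : ∀ (t₁ t₂ : ℝ≥0) (z : Z), flow (t₁ + t₂) z = (flow t₁ z).bind (flow t₂)

namespace PartialSemiflow

variable {Z : Type*} [TopologicalSpace Z] (π : PartialSemiflow Z)

/-- `π.mem t z M` means: `z π t` is defined and belongs to `M`. -/
def mem (t : ℝ≥0) (z : Z) (M : Set Z) : Prop := ∃ w ∈ M, π.flow t z = some w

/-- `π.segMem t z M` means `z π [0,t] ⊆ M`. -/
def segMem (t : ℝ≥0) (z : Z) (M : Set Z) : Prop := ∀ s ≤ t, π.mem s z M

/-- A full solution `u : ℝ → Z` of the semiflow. -/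
def IsSolution (u : ℝ → Z) : Prop :=
  ∀ (t₀ : ℝ) (s : ℝ≥0), π.flow s (u t₀) = some (u (t₀ + (s : ℝ)))

/-- The largest invariant subset of `N`. -/
def Inv (N : Set Z) : Set Z :=
  {z | ∃ u : ℝ → Z, π.IsSolution u ∧ (∀ t, u t ∈ N) ∧ u 0 = z}

/-- The largest negatively invariant subset of `N` (solutions on `(-∞,0]`). -/
def InvMinus (N : Set Z) : Set Z :=
  {z | ∃ u : ℝ → Z, (∀ t ≤ (0 : ℝ), u t ∈ N) ∧
    (∀ (t₀ : ℝ) (s : ℝ≥0), t₀ + (s : ℝ) ≤ 0 → π.flow s (u t₀) = some (u (t₀ + (s : ℝ)))) ∧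
    u 0 = z}

/-- Strong admissibility of a set `M`: asymptotic compactness together with
non-explosion of the semiflow in `M`. -/
def StronglyAdmissible (M : Set Z) : Prop :=
  (∀ (z : ℕ → Z) (t : ℕ → ℝ≥0),
      (∀ n, π.segMem (t n) (z n) M) →
      ∃ w : ℕ → Z, (∀ n, π.flow (t n) (z n) = some (w n)) ∧
        ∃ φ : ℕ → ℕ, StrictMono φ ∧ ∃ l : Z, Tendsto (w ∘ φ) atTop (nhds l)) ∧
  (∀ (z : Z) (t : ℝ≥0), (∀ s < t, ∃ w ∈ M, π.flow s z = some w) → (π.flow t z).isSome)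

end PartialSemiflow

/-- A global (everywhere defined) semiflow on `Y`, the "translation" `y ↦ y^t`. -/
structure GlobalSemiflow (Y : Type*) [TopologicalSpace Y] where
  /-- The translation map. -/
  trans : ℝ≥0 → Y → Y
  continuous_trans : Continuous fun p : ℝ≥0 × Y => trans p.1 p.2
  trans_zero : ∀ y, trans 0 y = y
  trans_add : ∀ (s t : ℝ≥0) (y : Y), trans (s + t) y = trans t (trans s y)

variable {X Y : Type*} [MetricSpace X] [MetricSpace Y]

/-- `π` is a skew-product semiflow over the translation semiflow `σ`:  whenever
`(y,x) π t` is defined, its first component is `y^t`. -/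
def GlobalSemiflow.IsSkewProduct (σ : GlobalSemiflow Y) (π : PartialSemiflow (Y × X)) : Prop :=
  ∀ (t : ℝ≥0) (y : Y) (x : X) (w : Y × X), π.flow t (y, x) = some w → w.1 = σ.trans t y

/-- The positive hull `H⁺(y₀)` of `y₀`. -/
def hullPlus (σ : GlobalSemiflow Y) (y₀ : Y) : Set Y :=
  closure {y | ∃ t : ℝ≥0, σ.trans t y₀ = y}

/-- The space `H⁺(y₀) × X`, as a subset of `Y × X`. -/
def extSpace (σ : GlobalSemiflow Y) (y₀ : Y) : Set (Y × X) :=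
  (hullPlus σ y₀) ×ˢ (Set.univ : Set X)

/-- The map `r = r_{y₀} : [0,∞) × X → H⁺(y₀) × X`, `r(t,x) = (y₀^t, x)`. -/
def rMap (σ : GlobalSemiflow Y) (y₀ : Y) : ℝ≥0 × X → Y × X :=
  fun p => (σ.trans p.1 y₀, p.2)

/-- The canonical semiflow `χ = χ_{y₀}` on `[0,∞) × X`:
`(t,x) χ s = (t+s, Φ(s, y₀^t, x))`. -/
def chi (σ : GlobalSemiflow Y) (π : PartialSemiflow (Y × X)) (y₀ : Y)
    (s : ℝ≥0) (p : ℝ≥0 × X) : Option (ℝ≥0 × X) :=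
  (π.flow s (σ.trans p.1 y₀, p.2)).map fun w => (p.1 + s, w.2)

/-- `chiMem σ π y₀ s p M` means: `p χ s` is defined and belongs to `M`. -/
def chiMem (σ : GlobalSemiflow Y) (π : PartialSemiflow (Y × X)) (y₀ : Y)
    (s : ℝ≥0) (p : ℝ≥0 × X) (M : Set (ℝ≥0 × X)) : Prop :=
  ∃ q ∈ M, chi σ π y₀ s p = some q

/-- `N` is an isolating neighborhood for `K` in `H⁺(y₀) × X`. -/
def IsIsolatingNbhd (σ : GlobalSemiflow Y) (π : PartialSemiflow (Y × X)) (y₀ : Y)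
    (K N : Set (Y × X)) : Prop :=
  N ⊆ extSpace σ y₀ ∧ IsClosed N ∧
  (∀ z ∈ π.Inv N, N ∈ nhdsWithin z (extSpace σ y₀)) ∧ K = π.Inv N

/-- `W` is a neighborhood of `K` in `H⁺(y₀) × X`. -/
def IsNbhdOfIn (σ : GlobalSemiflow Y) (y₀ : Y) (K W : Set (Y × X)) : Prop :=
  W ⊆ extSpace σ y₀ ∧ ∀ z ∈ K, W ∈ nhdsWithin z (extSpace (X := X) σ y₀)

/-- A basic index pair in `[0,∞) × X` relative to the semiflow `χ_{y₀}`. -/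
structure IsBasicIndexPair (σ : GlobalSemiflow Y) (π : PartialSemiflow (Y × X)) (y₀ : Y)
    (N₁ N₂ : Set (ℝ≥0 × X)) : Prop where
  subset : N₂ ⊆ N₁
  closed₁ : IsClosed N₁
  closed₂ : IsClosed N₂
  ip2 : ∀ p ∈ N₁, ∀ t : ℝ≥0, ¬ chiMem σ π y₀ t p N₁ → ∃ s ≤ t, chiMem σ π y₀ s p N₂
  ip3 : ∀ p ∈ N₂, ∀ t : ℝ≥0, ¬ chiMem σ π y₀ t p N₂ → ∃ s ≤ t, ¬ chiMem σ π y₀ s p N₁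

/-- An index pair for `(y₀, K)`. -/
structure IsIndexPair (σ : GlobalSemiflow Y) (π : PartialSemiflow (Y × X)) (y₀ : Y)
    (K : Set (Y × X)) (N₁ N₂ : Set (ℝ≥0 × X)) : Prop where
  toBasic : IsBasicIndexPair σ π y₀ N₁ N₂
  ip4 : ∃ N : Set (Y × X), IsIsolatingNbhd σ π y₀ K N ∧ π.StronglyAdmissible N ∧
    N₁ \ N₂ ⊆ rMap σ y₀ ⁻¹' N
  ip5 : ∃ W : Set (Y × X), IsNbhdOfIn σ y₀ K W ∧ rMap σ y₀ ⁻¹' W ⊆ N₁ \ N₂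

/-- `N₂^{-T}(N₁) = {p ∈ N₁ : p χ s ∈ N₂ for some s ∈ [0,T]}`. -/
def backSet (σ : GlobalSemiflow Y) (π : PartialSemiflow (Y × X)) (y₀ : Y)
    (N₁ N₂ : Set (ℝ≥0 × X)) (T : ℝ≥0) : Set (ℝ≥0 × X) :=
  {p ∈ N₁ | ∃ s ≤ T, chiMem σ π y₀ s p N₂}


/-- The relation identifying all points of `A ∩ B`, together with an extra point
(which serves as the class `[B]` even when `A ∩ B = ∅`). -/
def quotRel {Z : Type*} (A B : Set Z) : ↥A ⊕ Unit → ↥A ⊕ Unit → Prop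
  | Sum.inl a, Sum.inl b => a = b ∨ ((a : Z) ∈ B ∧ (b : Z) ∈ B)
  | Sum.inl a, Sum.inr _ => (a : Z) ∈ B
  | Sum.inr _, Sum.inl b => (b : Z) ∈ B
  | Sum.inr _, Sum.inr _ => True

/-- The pointed quotient space `A/B`. -/
def PtdQuot {Z : Type*} [TopologicalSpace Z] (A B : Set Z) : Type _ := Quot (quotRel A B)

instance {Z : Type*} [TopologicalSpace Z] (A B : Set Z) : TopologicalSpace (PtdQuot A B) :=
  inferInstanceAs (TopologicalSpace (Quot _))

/-- The base point `[B]` of `A/B`. -/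
def PtdQuot.pt {Z : Type*} [TopologicalSpace Z] (A B : Set Z) : PtdQuot A B :=
  Quot.mk _ (Sum.inr ())

/-- `f : (Z, z₀) → (W, w₀)` is a pointed homotopy equivalence. -/
def IsPointedHomotopyEquiv {Z W : Type*} [TopologicalSpace Z] [TopologicalSpace W]
    (z₀ : Z) (w₀ : W) (f : C(Z, W)) : Prop :=
  f z₀ = w₀ ∧ ∃ g : C(W, Z), g w₀ = z₀ ∧
    Nonempty (ContinuousMap.HomotopyRel (g.comp f) (ContinuousMap.id Z) {z₀}) ∧
    Nonempty (ContinuousMap.HomotopyRel (f.comp g) (ContinuousMap.id W) {w₀})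

/-- There is a pointed homotopy equivalence `(Z,z₀) → (W,w₀)`. -/
def PointedHomotopyEquivalent {Z W : Type*} [TopologicalSpace Z] [TopologicalSpace W]
    (z₀ : Z) (w₀ : W) : Prop :=
  ∃ f : C(Z, W), IsPointedHomotopyEquiv z₀ w₀ f

variable {X Y : Type*} [MetricSpace X] [MetricSpace Y]

/-- `g⁺(z) = sup{t ≥ 0 : z π [0,t] ⊆ U}`, with `sup ∅ = 0`, valued in `[0,∞]`. -/
def gPlus (π : PartialSemiflow (Y × X)) (U : Set (Y × X)) (z : Y × X) : ℝ≥0∞ :=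
  ⨆ t ∈ {t : ℝ≥0 | π.segMem t z U}, (t : ℝ≥0∞)

/-- `g⁻(z) = sup{d(z π t, Inv⁻(N)) : t ∈ [0, g⁺(z)], z π t ≠ ◊}`, with `sup ∅ = 0`
and `d(·,∅) = ∞`, valued in `[0,∞]`. -/
def gMinus (π : PartialSemiflow (Y × X)) (U N : Set (Y × X)) (z : Y × X) : ℝ≥0∞ :=
  ⨆ t ∈ {t : ℝ≥0 | (t : ℝ≥0∞) ≤ gPlus π U z},
    ⨆ w ∈ {w : Y × X | π.flow t z = some w}, EMetric.infEdist w (π.InvMinus N)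

/-- The function `f(p) = sup{t₀ ≥ 0 : p χ s ∈ cl(N₁ \ N₂) for all s ∈ [0,t₀]}`,
with `sup ∅ = 0`, valued in `[0,∞]`. -/
def fTime (σ : GlobalSemiflow Y) (π : PartialSemiflow (Y × X)) (y₀ : Y)
    (N₁ N₂ : Set (ℝ≥0 × X)) (p : ℝ≥0 × X) : ℝ≥0∞ :=
  ⨆ t₀ ∈ {t₀ : ℝ≥0 | ∀ s ≤ t₀, chiMem σ π y₀ s p (closure (N₁ \ N₂))}, (t₀ : ℝ≥0∞)

/-- The α-limit set of a full solution `u`. -/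
def solAlphaLimit (u : ℝ → Y × X) : Set (Y × X) := ⋂ t : ℝ, closure (u '' Set.Iic t)

/-- The ω-limit set of a full solution `u`. -/
def solOmegaLimit (u : ℝ → Y × X) : Set (Y × X) := ⋂ t : ℝ, closure (u '' Set.Ici t)

/-- `(A, R)` is an attractor-repeller decomposition of the isolated invariant set `K`. -/
structure IsARDecomp (σ : GlobalSemiflow Y) (π : PartialSemiflow (Y × X)) (y₀ : Y)
    (K A R : Set (Y × X)) : Prop where
  A_subset : A ⊆ K
  R_subset : R ⊆ K
  disjoint : Disjoint A R
  A_isolated : ∃ N, IsIsolatingNbhd σ π y₀ A N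
  R_isolated : ∃ N, IsIsolatingNbhd σ π y₀ R N
  alternatives : ∀ u : ℝ → Y × X, π.IsSolution u → (∀ t, u t ∈ K) →
    (∀ t, u t ∈ A) ∨ (∀ t, u t ∈ R) ∨ (solAlphaLimit u ⊆ R ∧ solOmegaLimit u ⊆ A)

/-- An index triple for `(y₀, K, A, R)`. -/
structure IsIndexTriple (σ : GlobalSemiflow Y) (π : PartialSemiflow (Y × X)) (y₀ : Y)
    (K A R : Set (Y × X)) (N₁ N₂ N₃ : Set (ℝ≥0 × X)) : Prop where
  sub32 : N₃ ⊆ N₂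
  sub21 : N₂ ⊆ N₁
  pairK : IsIndexPair σ π y₀ K N₁ N₃
  pairA : IsIndexPair σ π y₀ A N₂ N₃

/-- An FM-index pair for `K` relative to `π`, restricted to `H⁺(y₀) × X`. -/
structure IsFMIndexPair (σ : GlobalSemiflow Y) (π : PartialSemiflow (Y × X)) (y₀ : Y)
    (K N₁ N₂ : Set (Y × X)) : Prop where
  subset : N₂ ⊆ N₁
  sub_ext : N₁ ⊆ extSpace σ y₀
  closed₁ : IsClosed N₁
  closed₂ : IsClosed N₂
  isolating : IsIsolatingNbhd σ π y₀ K (closure (N₁ \ N₂))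
  interior_K : ∀ z ∈ K, N₁ \ N₂ ∈ nhdsWithin z (extSpace σ y₀)
  posInv : ∀ z ∈ N₂, ∀ t : ℝ≥0, (∀ s ≤ t, π.mem s z N₁) → ∀ s ≤ t, π.mem s z N₂
  exit : ∀ z ∈ N₁, ∀ t : ℝ≥0, ¬ π.mem t z N₁ →
    ∃ s ≤ t, (∀ s' ≤ s, π.mem s' z N₁) ∧ π.mem s z N₂


namespace PartialSemiflow

/-- Sequential continuity of the flow at a fixed time. -/
theorem tendsto_of_flow_eq_some {Z : Type*} [TopologicalSpace Z] (π : PartialSemiflow Z)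
    {s : ℝ≥0} {a b : ℕ → Z} {l m : Z} (ha : Tendsto a atTop (𝓝 l)) (hm : π.flow s l = some m)
    (hab : ∀ᶠ n in atTop, π.flow s (a n) = some (b n)) : Tendsto b atTop (𝓝 m) := by
  rw [tendsto_nhds]
  intro V hV hmV
  have hO : IsOpen {z : Z | ∃ v ∈ V, π.flow s z = some v} :=
    (π.continuous_flow V hV).preimage (Continuous.prodMk_right s)
  filter_upwards [hab, ha.eventually (hO.mem_nhds ⟨m, hmV, hm⟩)] with n h₁ h₂
  obtain ⟨v, hv, hvn⟩ := h₂
  rw [h₁, Option.some_inj] at hvn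
  show b n ∈ V
  rwa [hvn]

/-- A forward orbit that stays in a non-explosive set as long as it is defined is defined
for all times. -/
theorem isSome_flow_of_forall_mem {Z : Type*} [TopologicalSpace Z] (π : PartialSemiflow Z)
    {N : Set Z} {z : Z}
    (hN : ∀ t : ℝ≥0, (∀ s < t, ∃ w ∈ N, π.flow s z = some w) → (π.flow t z).isSome)
    (hz : ∀ (s : ℝ≥0) (m : Z), π.flow s z = some m → m ∈ N) (t : ℝ≥0) :
    (π.flow t z).isSome := by
  by_contra ht
  set S : Set ℝ≥0 := {s | ¬ (π.flow s z).isSome = true} with hS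
  have hSc : IsClosed S := by
    have hO : IsOpen {s : ℝ≥0 | (π.flow s z).isSome = true} :=
      π.isOpen_dom.preimage (Continuous.prodMk_left z)
    exact isOpen_compl_iff.1 (by simpa only [hS, compl_ofPred, not_not] using hO)
  have hmem : sInf S ∈ S := hSc.csInf_mem ⟨t, ht⟩ (OrderBot.bddBelow S)
  refine hmem (hN _ fun s hs => ?_)
  have hsS : s ∉ S := notMem_of_lt_csInf hs (OrderBot.bddBelow S)
  obtain ⟨m, hm⟩ := Option.isSome_iff_exists.1 (not_not.1 hsS)
  exact ⟨m, hz s m hm, hm⟩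

/-- `z` is a limit of interior points of orbit segments in `N` that extend arbitrarily far into
the past and into the future. -/
def IsLongSegmentLimit {Z : Type*} [TopologicalSpace Z] (π : PartialSemiflow Z) (N : Set Z)
    (z : Z) : Prop :=
  ∃ (a : ℕ → Z) (t s : ℕ → ℝ≥0) (w : ℕ → Z), (∀ n : ℕ, (n : ℝ≥0) ≤ t n ∧ (n : ℝ≥0) ≤ s n) ∧
    (∀ n, π.segMem (t n + s n) (a n) N) ∧ (∀ n, π.flow (t n) (a n) = some (w n)) ∧
    Tendsto w atTop (𝓝 z)

theorem IsLongSegmentLimit.exists_flow_eq {Z : Type*} [TopologicalSpace Z]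
    {π : PartialSemiflow Z} {N : Set Z} {z : Z} (hz : π.IsLongSegmentLimit N z)
    (hNc : IsClosed N) (hN : π.StronglyAdmissible N) (r : ℝ≥0) :
    ∃ m ∈ N, π.flow r z = some m := by
  obtain ⟨a, t, s, w, hts, hseg, hw, hwz⟩ := hz
  have key : ∀ (r : ℝ≥0) (m : Z), π.flow r z = some m → m ∈ N := by
    intro r m hm
    have h : ∀ n : ℕ, ∃ b, r ≤ n → b ∈ N ∧ π.flow r (w n) = some b := by
      intro n
      by_cases hr : r ≤ n
      · obtain ⟨b, hb, hb'⟩ := hseg n (t n + r) (by gcongr; exact hr.trans (hts n).2)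
        rw [π.flow_add, hw n, Option.bind_some] at hb'
        exact ⟨b, fun _ => ⟨hb, hb'⟩⟩
      · exact ⟨z, fun h => absurd h hr⟩
    choose b hb using h
    have hev : ∀ᶠ n : ℕ in atTop, r ≤ n := by
      obtain ⟨k, hk⟩ := exists_nat_ge r
      filter_upwards [eventually_ge_atTop k] with n hn
      exact hk.trans (by exact_mod_cast hn)
    exact hNc.mem_of_tendsto
      (π.tendsto_of_flow_eq_some hwz hm (hev.mono fun n hn => (hb n hn).2))
      (hev.mono fun n hn => (hb n hn).1)
  obtain ⟨m, hm⟩ := Option.isSome_iff_exists.1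
    (π.isSome_flow_of_forall_mem (hN.2 z) key r)
  exact ⟨m, key r m hm, hm⟩

theorem IsLongSegmentLimit.exists_pred {Z : Type*} [TopologicalSpace Z] [T2Space Z]
    {π : PartialSemiflow Z} {N : Set Z} {z : Z} (hz : π.IsLongSegmentLimit N z)
    (hNc : IsClosed N) (hN : π.StronglyAdmissible N) :
    ∃ z', π.IsLongSegmentLimit N z' ∧ π.flow 1 z' = some z := by
  obtain ⟨a, t, s, w, hts, hseg, hw, hwz⟩ := hz
  have ht1 : ∀ n, (1 : ℝ≥0) ≤ t (n + 1) := fun n =>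
    le_trans (by simp) (hts (n + 1)).1
  obtain ⟨v, hv, φ, hφ, l, hl⟩ := hN.1 (fun n => a (n + 1)) (fun n => t (n + 1) - 1)
    (fun n r hr => hseg (n + 1) r (hr.trans (tsub_le_self.trans le_self_add)))
  have hlong : π.IsLongSegmentLimit N l := by
    refine ⟨fun n => a (φ n + 1), fun n => t (φ n + 1) - 1, fun n => s (φ n + 1) + 1, v ∘ φ,
      fun n => ⟨?_, ?_⟩, fun n => ?_, fun n => hv (φ n), hl⟩
    · have h₁ := (hts (φ n + 1)).1
      have h₂ : (n : ℝ≥0) ≤ φ n := by exact_mod_cast hφ.id_le n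
      refine le_tsub_of_add_le_right (le_trans ?_ h₁)
      push_cast
      gcongr
    · have h₁ := (hts (φ n + 1)).2
      have h₂ : (n : ℝ≥0) ≤ φ n := by exact_mod_cast hφ.id_le n
      push_cast at h₁
      exact (h₂.trans le_self_add).trans (h₁.trans le_self_add)
    · have h : t (φ n + 1) - 1 + (s (φ n + 1) + 1) = t (φ n + 1) + s (φ n + 1) := by
        rw [add_comm (s _), ← add_assoc, tsub_add_cancel_of_le (ht1 _)]
      rw [h]
      exact hseg _
  refine ⟨l, hlong, ?_⟩
  obtain ⟨m, -, hm⟩ := hlong.exists_flow_eq hNc hN 1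
  have hstep : ∀ n, π.flow 1 ((v ∘ φ) n) = some (w (φ n + 1)) := by
    intro n
    have h := hw (φ n + 1)
    rw [← tsub_add_cancel_of_le (ht1 (φ n)), π.flow_add, hv (φ n), Option.bind_some] at h
    exact h
  have hlim : Tendsto (fun n => w (φ n + 1)) atTop (𝓝 z) :=
    hwz.comp ((tendsto_add_atTop_nat 1).comp hφ.tendsto_atTop)
  rw [hm, tendsto_nhds_unique
    (π.tendsto_of_flow_eq_some hl hm (Eventually.of_forall hstep)) hlim]

/-- A backward sequence of points with globally defined forward orbits in `N` yields a full
solution in `N`. -/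
theorem mem_Inv_of_backward_sequence {Z : Type*} [TopologicalSpace Z] (π : PartialSemiflow Z)
    {N : Set Z} (g : ℕ → Z) (hg : ∀ k, π.flow 1 (g (k + 1)) = some (g k))
    (hgN : ∀ k r, ∃ m ∈ N, π.flow r (g k) = some m) : g 0 ∈ π.Inv N := by
  choose G hGN hG using hgN
  have hgn : ∀ k n : ℕ, π.flow n (g (k + n)) = some (g k) := by
    intro k n
    induction n with
    | zero => simpa using π.flow_zero (g k)
    | succ n ih =>
      rw [Nat.cast_succ, add_comm (n : ℝ≥0), π.flow_add, ← add_assoc, hg, Option.bind_some, ih]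
  have hcons : ∀ (k n : ℕ) (r : ℝ≥0), G (k + n) (n + r) = G k r := by
    intro k n r
    have h := hG (k + n) (n + r)
    rw [π.flow_add, hgn, Option.bind_some, hG] at h
    exact (Option.some_inj.1 h).symm
  set u : ℝ → Z := fun t => G ⌈|t|⌉₊ (t + ⌈|t|⌉₊).toNNReal with hu
  have huG : ∀ (t : ℝ) (k : ℕ), |t| ≤ k → u t = G k (t + k).toNNReal := by
    intro t k hk
    obtain ⟨n, hn⟩ := Nat.exists_eq_add_of_le (Nat.ceil_le.2 hk)
    have hpos : 0 ≤ t + (⌈|t|⌉₊ : ℝ) := by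
      have h₁ := Nat.le_ceil |t|
      have h₂ := neg_abs_le t
      linarith
    have h : (t + k).toNNReal = n + (t + (⌈|t|⌉₊ : ℝ)).toNNReal := by
      rw [← Real.toNNReal_natCast n, ← Real.toNNReal_add n.cast_nonneg hpos, hn]
      push_cast
      ring_nf
    rw [h, hn, hcons]
  refine ⟨u, fun t₀ s => ?_, fun t => hGN _ _, ?_⟩
  · obtain ⟨k, hk⟩ := exists_nat_ge (|t₀| + s)
    have hs : (0 : ℝ) ≤ s := s.2
    have h₁ : |t₀| ≤ k := by linarith
    have h₂ : |t₀ + s| ≤ k :=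
      (abs_add_le _ _).trans (by rwa [abs_of_nonneg hs])
    have hpos : 0 ≤ t₀ + (k : ℝ) := by
      have := neg_abs_le t₀
      linarith
    have hsum : (t₀ + s + k).toNNReal = (t₀ + k).toNNReal + s := by
      rw [add_right_comm, Real.toNNReal_add hpos hs, Real.toNNReal_coe]
    have h := hG k ((t₀ + k).toNNReal + s)
    rw [π.flow_add, hG, Option.bind_some, ← huG t₀ k h₁, ← hsum, ← huG _ k h₂] at h
    exact h
  · have h := hG 0 0
    rw [π.flow_zero] at h
    rw [huG 0 0 (by simp)]
    simpa using (Option.some_inj.1 h).symm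

theorem IsLongSegmentLimit.mem_Inv {Z : Type*} [TopologicalSpace Z] [T2Space Z]
    {π : PartialSemiflow Z} {N : Set Z} {z : Z} (hz : π.IsLongSegmentLimit N z)
    (hNc : IsClosed N) (hN : π.StronglyAdmissible N) : z ∈ π.Inv N := by
  choose pred hpred hflow using fun x : {x // π.IsLongSegmentLimit N x} =>
    x.2.exists_pred hNc hN
  let g : ℕ → {x // π.IsLongSegmentLimit N x} :=
    fun n => Nat.rec ⟨z, hz⟩ (fun _ x => ⟨pred x, hpred x⟩) n
  exact π.mem_Inv_of_backward_sequence (fun n => (g n).1) (fun k => hflow (g k))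
    (fun k r => (g k).2.exists_flow_eq hNc hN r)

end PartialSemiflow

theorem continuous_rMap (σ : GlobalSemiflow Y) (y₀ : Y) :
    Continuous (rMap (X := X) σ y₀) :=
  (σ.continuous_trans.comp (continuous_fst.prodMk continuous_const)).prodMk continuous_snd

theorem flow_rMap_of_chi {σ : GlobalSemiflow Y} {π : PartialSemiflow (Y × X)}
    (hσπ : σ.IsSkewProduct π) {y₀ : Y} {s : ℝ≥0} {p q : ℝ≥0 × X}
    (h : chi σ π y₀ s p = some q) : π.flow s (rMap σ y₀ p) = some (rMap σ y₀ q) := by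
  obtain ⟨w, hw, rfl⟩ := Option.map_eq_some_iff.1 h
  have hw₁ := hσπ _ _ _ _ hw
  rw [← σ.trans_add] at hw₁
  exact hw.trans (congrArg some (Prod.ext hw₁ rfl))

/-- The exit set of a basic index pair is positively invariant relative to `N₁`. -/
theorem IsBasicIndexPair.chiMem_of_forall_le {σ : GlobalSemiflow Y}
    {π : PartialSemiflow (Y × X)} {y₀ : Y} {N₁ N₂ : Set (ℝ≥0 × X)}
    (h : IsBasicIndexPair σ π y₀ N₁ N₂) {p : ℝ≥0 × X} (hp : p ∈ N₂) {t : ℝ≥0}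
    (ht : ∀ s ≤ t, chiMem σ π y₀ s p N₁) : chiMem σ π y₀ t p N₂ := by
  by_contra hc
  obtain ⟨s, hs, hs'⟩ := h.ip3 p hp t hc
  exact hs' (ht s hs)

theorem statement_16 (σ : GlobalSemiflow Y) (π : PartialSemiflow (Y × X)) (hσπ : σ.IsSkewProduct π) (y₀ : Y)
    (K : Set (Y × X)) (hKsub : K ⊆ extSpace σ y₀) (hKinv : K = π.Inv K)
    (N₁ N₂ : Set (ℝ≥0 × X)) (hN : IsIndexPair σ π y₀ K N₁ N₂) :
    ∃ C : ℝ≥0, ∀ p ∈ N₂, fTime σ π y₀ N₁ N₂ p ≤ (C : ℝ≥0∞) := by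
  obtain ⟨N, ⟨hNext, hNc, -, hKN⟩, hadm, hsubN⟩ := hN.ip4
  obtain ⟨W, ⟨-, hW⟩, hWN⟩ := hN.ip5
  by_contra! hcon
  have hclN : closure (N₁ \ N₂) ⊆ rMap σ y₀ ⁻¹' N :=
    closure_minimal hsubN (hNc.preimage (continuous_rMap σ y₀))
  have hclN₁ : closure (N₁ \ N₂) ⊆ N₁ := closure_minimal sdiff_subset hN.toBasic.closed₁
  have hlong : ∀ n : ℕ, ∃ p ∈ N₂, ∀ s ≤ (n + n : ℝ≥0),
      chiMem σ π y₀ s p (closure (N₁ \ N₂)) := by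
    intro n
    obtain ⟨p, hp, hlt⟩ := hcon (n + n)
    obtain ⟨t, hlt⟩ := lt_iSup_iff.1 hlt
    obtain ⟨ht, hlt⟩ := lt_iSup_iff.1 hlt
    exact ⟨p, hp, fun s hs => ht s (hs.trans (by exact_mod_cast hlt.le))⟩
  choose p hp hseg using hlong
  have hexit : ∀ n : ℕ, chiMem σ π y₀ n (p n) N₂ := fun n =>
    hN.toBasic.chiMem_of_forall_le (hp n) fun s hs =>
      let ⟨q, hq, hq'⟩ := hseg n s (hs.trans le_self_add)
      ⟨q, hclN₁ hq, hq'⟩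
  choose q hq hpq using hexit
  have hsegN : ∀ n : ℕ, π.segMem (n + n) (rMap σ y₀ (p n)) N := fun n s hs =>
    let ⟨x, hx, hx'⟩ := hseg n s hs
    ⟨_, hclN hx, flow_rMap_of_chi hσπ hx'⟩
  have hflow : ∀ n : ℕ, π.flow n (rMap σ y₀ (p n)) = some (rMap σ y₀ (q n)) := fun n =>
    flow_rMap_of_chi hσπ (hpq n)
  obtain ⟨w, hw, φ, hφ, l, hl⟩ := hadm.1 (fun n => rMap σ y₀ (p n)) (fun n => n)
    (fun n s hs => hsegN n s (hs.trans le_self_add))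
  have hwq : ∀ n, w n = rMap σ y₀ (q n) := fun n =>
    Option.some_inj.1 ((hw n).symm.trans (hflow n))
  have hφn : ∀ n : ℕ, (n : ℝ≥0) ≤ φ n := fun n => by exact_mod_cast hφ.id_le n
  have hlK : l ∈ K := by
    rw [hKN]
    exact PartialSemiflow.IsLongSegmentLimit.mem_Inv
      ⟨fun n => rMap σ y₀ (p (φ n)), fun n => φ n, fun n => φ n, w ∘ φ,
        fun n => ⟨hφn n, hφn n⟩, fun n => hsegN (φ n), fun n => hw (φ n), hl⟩ hNc hadm
  have hwext : ∀ n, (w ∘ φ) n ∈ extSpace σ y₀ := fun n => by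
    obtain ⟨x, hx, hx'⟩ := hsegN (φ n) (φ n) le_self_add
    rw [Option.some_inj.1 (hx'.symm.trans (hw (φ n)))] at hx
    exact hNext hx
  have hev : ∀ᶠ n in atTop, (w ∘ φ) n ∈ W :=
    (tendsto_nhdsWithin_iff.2 ⟨hl, Eventually.of_forall hwext⟩).eventually (hW l hlK)
  obtain ⟨n, hn⟩ := hev.exists
  rw [Function.comp_apply, hwq] at hn
  exact (hWN hn).2 (hq (φ n))

end
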